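/- Let T = k[x,y] be a polynomial ring in two variables over an algebraically closed field k and let R := k + xT. Then T is a saturated depiction of R: for every prime t of T minimal over the ideal (t ∩ R)T, ght_R(t ∩ R) = ht_T(t). Moreover R is not noetherian in codimension 1, since the localization R_{xT ∩ R} is not noetherian. -/

import Mathlib

/-! Common framework: depictions of nonnoetherian integral domains (Beil).
`K` plays the role of the fraction field `Frac R`; all rings are `k`-subalgebras of `K`. -/

section Depictions

variable {k K : Type*} [Field k] [Field K] [Algebra k K]

/-- The localization `A_p` of a subalgebra `A ⊆ K` at a prime ideal `p`,
viewed as a subalgebra of `K`. -/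
def locAt (A : Subalgebra k K) (p : Ideal A) (hp : p.IsPrime) : Subalgebra k K where
  carrier := {x : K | ∃ a s : A, s ∉ p ∧ x * (s : K) = (a : K)}
  one_mem' := ⟨1, 1, (Ideal.ne_top_iff_one p).mp hp.ne_top, by simp⟩
  zero_mem' := ⟨0, 1, (Ideal.ne_top_iff_one p).mp hp.ne_top, by simp⟩
  mul_mem' := by
    rintro x y ⟨a, s, hs, hx⟩ ⟨b, t, ht, hy⟩
    refine ⟨a * b, s * t, fun h => ((hp.mem_or_mem h).elim hs ht), ?_⟩
    have : x * y * ((s : K) * (t : K)) = (x * s) * (y * t) := by ring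
    push_cast
    rw [this, hx, hy]
  add_mem' := by
    rintro x y ⟨a, s, hs, hx⟩ ⟨b, t, ht, hy⟩
    refine ⟨a * t + b * s, s * t, fun h => ((hp.mem_or_mem h).elim hs ht), ?_⟩
    have : (x + y) * ((s : K) * (t : K)) = (x * s) * t + (y * t) * s := by ring
    push_cast
    rw [this, hx, hy]
  algebraMap_mem' := fun c =>
    ⟨algebraMap k A c, 1, (Ideal.ne_top_iff_one p).mp hp.ne_top, by simp⟩

lemma mem_locAt {A : Subalgebra k K} {p : Ideal A} {hp : p.IsPrime} {x : K} :
    x ∈ locAt A p hp ↔ ∃ a s : A, s ∉ p ∧ x * (s : K) = (a : K) := Iff.rfl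

/-- `n ∈ U_{S/R}`: `n` is a maximal ideal of `S` with `R_{n ∩ R} = S_n`. -/
def memU (R S : Subalgebra k K) (h : R ≤ S) (n : Ideal S) : Prop :=
  ∃ hn : n.IsMaximal,
    locAt R (n.comap (Subalgebra.inclusion h)) (hn.isPrime.comap _) = locAt S n hn.isPrime

/-- `q ∈ Z_{S/R}`: `q` is a prime of `S` whose zero locus meets `U_{S/R}`,
i.e. some `n ∈ U_{S/R}` contains `q`. -/
def memZ (R S : Subalgebra k K) (h : R ≤ S) (q : Ideal S) : Prop :=
  q.IsPrime ∧ ∃ n : Ideal S, memU R S h n ∧ q ≤ n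

/-- `S` is a depiction of `R`. -/
structure IsDepiction (R S : Subalgebra k K) : Prop where
  le : R ≤ S
  fg : S.FG
  specSurj : ∀ p : Ideal R, p.IsPrime →
    ∃ q : Ideal S, q.IsPrime ∧ q.comap (Subalgebra.inclusion le) = p
  memU_iff : ∀ (n : Ideal S) (hn : n.IsMaximal),
    memU R S le n ↔
      IsNoetherianRing (locAt R (n.comap (Subalgebra.inclusion le)) (hn.isPrime.comap _))
  nonempty : ∃ n : Ideal S, memU R S le n

/-- The height of an ideal `q`, as the Krull dimension of the set of primes contained in `q`. -/
noncomputable def htOf {A : Type*} [CommRing A] (q : Ideal A) : WithBot ℕ∞ :=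
  Order.krullDim {p : PrimeSpectrum A // p.asIdeal ≤ q}

/-- The geometric height of a prime `p` of `R`: the minimum of the heights `ht_S q` over all
depictions `S` of `R` and primes `q` of `S` with `q ∩ R = p`. -/
noncomputable def ght (R : Subalgebra k K) (p : Ideal R) : WithBot ℕ∞ :=
  sInf {h | ∃ (S : Subalgebra k K) (hd : IsDepiction R S) (q : Ideal S),
    q.IsPrime ∧ q.comap (Subalgebra.inclusion hd.le) = p ∧ h = htOf q}

/-- The geometric dimension of a prime `p` of `R`: `gdim p = dim R - ght p`. -/
noncomputable def gdim (R : Subalgebra k K) (p : Ideal R) : WithBot ℕ∞ :=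
  Option.map₂ (· - ·) (ringKrullDim ↥R) (ght R p)

/-- `T := ⋂_{n ∈ U_{S/R}} S_n`, as a subalgebra of `K`. -/
noncomputable def depT (R S : Subalgebra k K) (h : R ≤ S) : Subalgebra k K :=
  sInf {L | ∃ (n : Ideal S) (hn : n.IsMaximal), memU R S h n ∧ L = locAt S n hn.isPrime}

lemma le_depT (R S : Subalgebra k K) (h : R ≤ S) : S ≤ depT R S h := by
  refine le_sInf ?_
  rintro L ⟨n, hn, -, rfl⟩
  intro x hx
  exact ⟨⟨x, hx⟩, 1, (Ideal.ne_top_iff_one n).mp hn.ne_top, by simp⟩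

/-- A depiction `S` of `R` witnesses `noetherian in codimension 1`:
every height 1 prime of `S` lies in `Z_{S/R}`. -/
def Witnessing (R S : Subalgebra k K) (h : R ≤ S) : Prop :=
  ∀ q : Ideal S, q.IsPrime → htOf q = 1 → memZ R S h q

/-- `R` is noetherian in codimension 1. -/
def NoethCodimOne (R : Subalgebra k K) : Prop :=
  ∃ (S : Subalgebra k K) (hd : IsDepiction R S), Witnessing R S hd.le

/-- A depiction `S` of `R` is saturated if `ght (q ∩ R) = ht_S q` for every prime `q` of `S`
minimal over `(q ∩ R)S`. -/
def IsSaturated (R S : Subalgebra k K) (h : R ≤ S) : Prop :=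
  ∀ q : Ideal S,
    q ∈ (Ideal.map (Subalgebra.inclusion h) (q.comap (Subalgebra.inclusion h))).minimalPrimes →
      ght R (q.comap (Subalgebra.inclusion h)) = htOf q

/-- The subalgebra `k + p ⊆ K`, for `p` an ideal of a subalgebra `S ⊆ K`. -/
def kPlus (S : Subalgebra k K) (p : Ideal S) : Subalgebra k K where
  carrier := {x : K | ∃ (c : k) (f : S), f ∈ p ∧ x = algebraMap k K c + (f : K)}
  one_mem' := ⟨1, 0, p.zero_mem, by simp⟩
  zero_mem' := ⟨0, 0, p.zero_mem, by simp⟩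
  mul_mem' := by
    rintro x y ⟨c, f, hf, rfl⟩ ⟨d, g, hg, rfl⟩
    refine ⟨c * d, algebraMap k S c * g + algebraMap k S d * f + f * g,
      add_mem (add_mem (p.mul_mem_left _ hg) (p.mul_mem_left _ hf)) (p.mul_mem_left _ hg),
      ?_⟩
    push_cast
    ring
  add_mem' := by
    rintro x y ⟨c, f, hf, rfl⟩ ⟨d, g, hg, rfl⟩
    exact ⟨c + d, f + g, add_mem hf hg, by push_cast; ring⟩
  algebraMap_mem' := fun c => ⟨c, 0, p.zero_mem, by simp⟩

lemma kPlus_le (S : Subalgebra k K) (p : Ideal S) : kPlus S p ≤ S := by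
  rintro x ⟨c, f, hf, rfl⟩
  exact add_mem (S.algebraMap_mem c) f.2

end Depictions

section Helpers

open Polynomial

lemma htOf_eq_height {A : Type*} [CommRing A] (q : Ideal A) [hq : q.IsPrime] :
    htOf q = q.height := by
  have := Order.height_eq_krullDim_Iic (⟨q, hq⟩ : PrimeSpectrum A)
  rw [← PrimeSpectrum.height_eq_orderHeight] at this
  exact this.symm

lemma one_le_htOf {A : Type*} [CommRing A] [IsDomain A] (q : Ideal A) [q.IsPrime] (h : q ≠ ⊥) :
    1 ≤ htOf q := by
  rw [htOf_eq_height]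
  have : q.height ≠ 0 := mt Ideal.height_eq_zero_iff_eq_bot.mp h
  exact_mod_cast Order.one_le_iff_ne_zero.mpr this

lemma htOf_le_one_of_mem_minimalPrimes {A : Type*} [CommRing A] [IsNoetherianRing A] {a : A}
    {q : Ideal A} (hq : q ∈ (Ideal.span {a}).minimalPrimes) : htOf q ≤ 1 := by
  have : q.IsPrime := hq.1.1
  rw [htOf_eq_height]
  exact_mod_cast Ideal.height_le_one_of_isPrincipal_of_mem_minimalPrimes _ _ hq

/-- Over a domain of dimension at most two, a non-maximal prime has height at most one. -/
lemma htOf_le_one_of_not_isMaximal {A : Type*} [CommRing A] (hA : ringKrullDim A ≤ 2)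
    (q : Ideal A) [hq : q.IsPrime] (h : ¬ q.IsMaximal) : htOf q ≤ 1 := by
  obtain ⟨n, hn, hqn⟩ := q.exists_le_maximal hq.ne_top
  have hlt : q < n := lt_of_le_of_ne hqn fun e => h (e ▸ hn)
  have := hn.isPrime
  have h1 := Ideal.height_add_one_le_of_lt_of_isPrime hlt
  have h2 : (n.height : WithBot ℕ∞) ≤ 2 := Ideal.height_le_ringKrullDim_of_isPrime.trans hA
  rw [htOf_eq_height]
  have h3 : n.height ≤ 2 := WithBot.coe_le_coe.mp h2
  have h4 : q.height ≤ 1 := by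
    have h5 : q.height + 1 ≤ 1 + 1 := (h1.trans h3).trans_eq one_add_one_eq_two.symm
    exact (ENat.add_le_add_iff_right ENat.one_ne_top).mp h5
  exact_mod_cast h4

variable {k K : Type*} [Field k] [Field K] [Algebra k K]

lemma locAt_congr {A : Subalgebra k K} {p q : Ideal A} (h : p = q) {hp : p.IsPrime}
    {hq : q.IsPrime} : locAt A p hp = locAt A q hq := by
  subst h; rfl

lemma le_locAt (A : Subalgebra k K) (p : Ideal A) (hp : p.IsPrime) : A ≤ locAt A p hp :=
  fun a ha => ⟨⟨a, ha⟩, 1, (Ideal.ne_top_iff_one p).mp hp.ne_top, by simp⟩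

noncomputable instance algebraLocAt (A : Subalgebra k K) (p : Ideal A) (hp : p.IsPrime) :
    Algebra A (locAt A p hp) :=
  (Subalgebra.inclusion (le_locAt A p hp)).toRingHom.toAlgebra

lemma coe_algebraMap_locAt {A : Subalgebra k K} {p : Ideal A} {hp : p.IsPrime} (a : A) :
    ((algebraMap A (locAt A p hp) a : locAt A p hp) : K) = a := rfl

instance isLocalization_locAt (A : Subalgebra k K) (p : Ideal A) [hp : p.IsPrime] :
    IsLocalization.AtPrime (locAt A p hp) p where
  map_units s := by
    have hs : ((s : A) : K) ≠ 0 := fun h => s.2 (by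
      have : (s : A) = 0 := Subtype.ext h
      rw [this]; exact p.zero_mem)
    have hmem : ((s : A) : K)⁻¹ ∈ locAt A p hp := ⟨1, s, s.2, by simp [hs]⟩
    refine IsUnit.of_mul_eq_one ⟨_, hmem⟩ (Subtype.ext ?_)
    simp [coe_algebraMap_locAt, hs]
  surj z := by
    obtain ⟨a, s, hs, h⟩ := z.2
    exact ⟨⟨a, s, hs⟩, Subtype.ext h⟩
  exists_of_eq {a b} h := by
    refine ⟨1, ?_⟩
    have : (a : K) = b := congrArg (fun z : locAt A p hp => (z : K)) h
    rw [Subtype.ext this]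

lemma isNoetherianRing_locAt (A : Subalgebra k K) [IsNoetherianRing A] (p : Ideal A)
    (hp : p.IsPrime) : IsNoetherianRing (locAt A p hp) :=
  IsLocalization.isNoetherianRing p.primeCompl _ inferInstance

lemma ringKrullDim_locAt (A : Subalgebra k K) (p : Ideal A) [hp : p.IsPrime] :
    ringKrullDim (locAt A p hp) = htOf p := by
  rw [htOf_eq_height]
  exact IsLocalization.AtPrime.ringKrullDim_eq_height p _

lemma locAt_comap_le {A B : Subalgebra k K} (h : A ≤ B) (q : Ideal B) (hq : q.IsPrime) :
    locAt A (q.comap (Subalgebra.inclusion h)) (hq.comap _) ≤ locAt B q hq := by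
  rintro z ⟨a, s, hs, hz⟩
  exact ⟨Subalgebra.inclusion h a, Subalgebra.inclusion h s, hs, hz⟩

/-- If `A ⊆ B` and `x ∉ q` lies in the conductor of `A` in `B`, then `A_{q ∩ A} = B_q`. -/
lemma locAt_comap_eq {A B : Subalgebra k K} (h : A ≤ B) {x : B} (hc : ∀ b : B, (x * b : K) ∈ A)
    (q : Ideal B) (hq : q.IsPrime) (hxq : x ∉ q) :
    locAt A (q.comap (Subalgebra.inclusion h)) (hq.comap _) = locAt B q hq := by
  refine (locAt_comap_le h q hq).antisymm ?_
  rintro z ⟨a, s, hs, hz⟩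
  refine ⟨⟨_, hc a⟩, ⟨_, hc s⟩, fun hmem => ?_, ?_⟩
  · have : x * s ∈ q := hmem
    exact (hq.mem_or_mem this).elim hxq hs
  · change z * (x * s) = x * a
    rw [← hz]; ring

/-- Maximal ideals of affine overrings contract to maximal ideals. -/
lemma isMaximal_comap_of_fg {A B : Subalgebra k K} (h : A ≤ B) (hB : B.FG) (n : Ideal B)
    (hn : n.IsMaximal) : (n.comap (Subalgebra.inclusion h)).IsMaximal := by
  have : Algebra.FiniteType k B := (Subalgebra.fg_iff_finiteType B).mp hB
  let _ : Field (B ⧸ n) := Ideal.Quotient.field n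
  have : Algebra.FiniteType k (B ⧸ n) := inferInstance
  have : Module.Finite k (B ⧸ n) := finite_of_finite_type_of_isJacobsonRing k (B ⧸ n)
  have : (n.comap (Subalgebra.inclusion h)).IsPrime := hn.isPrime.comap _
  let φ : (A ⧸ n.comap (Subalgebra.inclusion h)) →ₐ[k] B ⧸ n :=
    Ideal.quotientMapₐ n (Subalgebra.inclusion h) le_rfl
  have hφ : Function.Injective φ := Ideal.quotientMap_injective
  have := Algebra.IsIntegral.of_finite k (B ⧸ n)
  have hint : Algebra.IsIntegral k (A ⧸ n.comap (Subalgebra.inclusion h)) :=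
    Algebra.IsIntegral.of_injective φ hφ
  exact Ideal.Quotient.maximal_of_isField _ (isField_of_isIntegral_of_isField' (Field.toIsField k))

/-- Primes of `A` not containing the conductor element `x` lift to `B`. -/
lemma exists_isPrime_comap_eq {A B : Subalgebra k K} (h : A ≤ B) {x : B}
    (hc : ∀ b : B, (x * b : K) ∈ A) (p : Ideal A) (hp : p.IsPrime)
    {b₀ : B} (hb₀ : (⟨_, hc b₀⟩ : A) ∉ p) :
    ∃ q : Ideal B, q.IsPrime ∧ q.comap (Subalgebra.inclusion h) = p := by
  have hcf : ∀ b : B, (x * b₀ * b : K) ∈ A := fun b => by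
    simpa [mul_assoc] using hc (b₀ * b)
  let f : A := ⟨_, hc b₀⟩
  let q : Ideal B :=
    { carrier := {b | (⟨_, hcf b⟩ : A) ∈ p}
      zero_mem' := by
        have : (⟨_, hcf 0⟩ : A) = 0 := Subtype.ext (by simp)
        change (⟨_, hcf 0⟩ : A) ∈ p
        rw [this]; exact p.zero_mem
      add_mem' := fun {a b} ha hb => by
        have : (⟨_, hcf (a + b)⟩ : A) = ⟨_, hcf a⟩ + ⟨_, hcf b⟩ :=
          Subtype.ext (by simp [mul_add])
        change (⟨_, hcf (a + b)⟩ : A) ∈ p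
        rw [this]; exact p.add_mem ha hb
      smul_mem' := fun c b hb => by
        have : f * (⟨_, hcf (c * b)⟩ : A) = ⟨_, hcf c⟩ * ⟨_, hcf b⟩ :=
          Subtype.ext (by simp [f]; ring)
        have h2 : f * (⟨_, hcf (c * b)⟩ : A) ∈ p := by rw [this]; exact p.mul_mem_left _ hb
        exact (hp.mem_or_mem h2).resolve_left hb₀ }
  have hmem : ∀ b : B, b ∈ q ↔ (⟨_, hcf b⟩ : A) ∈ p := fun b => Iff.rfl
  have hcomap : q.comap (Subalgebra.inclusion h) = p := by
    ext r
    have : (⟨_, hcf (Subalgebra.inclusion h r)⟩ : A) = f * r := Subtype.ext (by simp [f])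
    rw [Ideal.mem_comap, hmem, this]
    exact ⟨fun hr => (hp.mem_or_mem hr).resolve_left hb₀, fun hr => p.mul_mem_left _ hr⟩
  refine ⟨q, ⟨?_, ?_⟩, hcomap⟩
  · intro htop
    apply hp.ne_top
    rw [← hcomap, htop, Ideal.comap_top]
  · intro a b hab
    rw [hmem] at hab ⊢
    rw [hmem]
    have : (⟨_, hcf a⟩ : A) * ⟨_, hcf b⟩ = f * (⟨_, hcf (a * b)⟩ : A) :=
      Subtype.ext (by simp [f]; ring)
    exact hp.mem_or_mem (this ▸ p.mul_mem_left f hab)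

/-- If `A_{n ∩ A} = B_n` and `q ⊆ n` is a prime of `B` with the same contraction as `n`,
then `q = n`. -/
lemma eq_of_comap_eq_of_memU {A B : Subalgebra k K} (h : A ≤ B) {n q : Ideal B}
    (hn : memU A B h n) (hq : q.IsPrime) (hqn : q ≤ n)
    (hc : q.comap (Subalgebra.inclusion h) = n.comap (Subalgebra.inclusion h)) : q = n := by
  obtain ⟨hmax, hloc⟩ := hn
  refine hqn.antisymm fun a ha => ?_
  have haA : (a : K) ∈ locAt B n hmax.isPrime := le_locAt _ _ _ a.2
  rw [← hloc] at haA
  obtain ⟨r, s, hs, hrs⟩ := haA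
  have hrs' : a * Subalgebra.inclusion h s = Subalgebra.inclusion h r := Subtype.ext hrs
  have hr : r ∈ n.comap (Subalgebra.inclusion h) := by
    rw [Ideal.mem_comap, ← hrs']; exact n.mul_mem_right _ ha
  rw [← hc] at hr hs
  rw [Ideal.mem_comap, ← hrs'] at hr
  exact (hq.mem_or_mem hr).resolve_right hs

/-- The height of a maximal ideal with noetherian contraction does not depend on the depiction. -/
lemma htOf_eq_of_comap_eq_isMaximal {R S T : Subalgebra k K} (hS : IsDepiction R S)
    (hT : IsDepiction R T) {n : Ideal T} (hn : memU R T hT.le n) (q : Ideal S) (hq : q.IsPrime)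
    (hqn : q.comap (Subalgebra.inclusion hS.le) = n.comap (Subalgebra.inclusion hT.le)) :
    htOf q = htOf n := by
  obtain ⟨hmax, hloc⟩ := id hn
  have hpmax := isMaximal_comap_of_fg hT.le hT.fg n hmax
  obtain ⟨m, hm, hqm⟩ := q.exists_le_maximal hq.ne_top
  have hmp := hm.isPrime
  have hcm : n.comap (Subalgebra.inclusion hT.le) = m.comap (Subalgebra.inclusion hS.le) :=
    hpmax.eq_of_le (hmp.comap _).ne_top (hqn ▸ Ideal.comap_mono hqm)
  have hnoeth := (hT.memU_iff n hmax).mp hn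
  have hmU : memU R S hS.le m := by
    rw [hS.memU_iff m hm]
    rwa [← locAt_congr hcm]
  have hqeq : q = m := eq_of_comap_eq_of_memU hS.le hmU hq hqm (hqn.trans hcm)
  subst hqeq
  obtain ⟨_, hloc'⟩ := hmU
  have hnp := hmax.isPrime
  rw [← ringKrullDim_locAt, ← ringKrullDim_locAt, ← hloc, ← hloc', locAt_congr hcm]

/-- If `R ⊆ T` consists of elements which are constant along `φ : T → k[X]`, and `x` lies in the
conductor, then the localization of `R` at the kernel of `φ` on `R` is not noetherian: the ideals of
elements `x t / s` with `φ t` of bounded degree form a strictly increasing chain. -/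
lemma not_isNoetherianRing_locAt {R T : Subalgebra k K} (hRT : R ≤ T) {x y : T} (hx : x ≠ 0)
    (hc : ∀ t : T, (x * t : K) ∈ R) (φ : T →ₐ[k] k[X]) (hy : φ y = X)
    (hφ : ∀ r : R, ∃ c : k, φ (Subalgebra.inclusion hRT r) = C c) (p : Ideal R) (hp : p.IsPrime)
    (hφp : ∀ r : R, φ (Subalgebra.inclusion hRT r) = 0 → r ∈ p) :
    ¬ IsNoetherianRing (locAt R p hp) := by
  intro hnoeth
  let ι := Subalgebra.inclusion hRT
  have hdeg : ∀ (r : R) (t : T) (n : ℕ), (φ t).natDegree ≤ n → (φ (ι r * t)).natDegree ≤ n := by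
    intro r t n ht
    obtain ⟨c, hc⟩ := hφ r
    rw [map_mul, hc]
    exact (natDegree_C_mul_le _ _).trans ht
  let I : ℕ → Ideal (locAt R p hp) := fun n =>
    { carrier := {f | ∃ s : R, s ∉ p ∧ ∃ t : T, (f : K) * s = x * t ∧ (φ t).natDegree ≤ n}
      zero_mem' := ⟨1, (Ideal.ne_top_iff_one p).mp hp.ne_top, 0, by simp, by simp⟩
      add_mem' := by
        rintro f g ⟨s, hs, t, hf, ht⟩ ⟨s', hs', t', hg, ht'⟩
        refine ⟨s * s', fun h => (hp.mem_or_mem h).elim hs hs', ι s' * t + ι s * t', ?_, ?_⟩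
        · have h1 : ((ι s' : T) : K) = s' := rfl
          have h2 : ((ι s : T) : K) = s := rfl
          push_cast
          rw [h1, h2]
          linear_combination (s' : K) * hf + (s : K) * hg
        · rw [map_add]
          exact natDegree_add_le_of_degree_le (hdeg _ _ _ ht) (hdeg _ _ _ ht')
      smul_mem' := by
        rintro ⟨g, a, s', hs', hg⟩ f ⟨s, hs, t, hf, ht⟩
        refine ⟨s' * s, fun h => (hp.mem_or_mem h).elim hs' hs, ι a * t, ?_, hdeg _ _ _ ht⟩
        have h1 : ((ι a : T) : K) = a := rfl
        simp only [smul_eq_mul]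
        push_cast
        rw [h1]
        linear_combination (f * s : K) * hg + (a : K) * hf }
  have hmono : Monotone I := by
    rintro m n hmn f ⟨s, hs, t, hf, ht⟩
    exact ⟨s, hs, t, hf, ht.trans hmn⟩
  obtain ⟨n, hn⟩ := monotone_stabilizes_iff_noetherian.mpr hnoeth ⟨I, hmono⟩
  have hn' : I n = I (n + 1) := hn (n + 1) n.le_succ
  let f : locAt R p hp := ⟨_, le_locAt R p hp (hc (y ^ (n + 1)))⟩
  have hf : f ∈ I (n + 1) :=
    ⟨1, (Ideal.ne_top_iff_one p).mp hp.ne_top, y ^ (n + 1), by simp [f], by simp [hy]⟩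
  rw [← hn'] at hf
  obtain ⟨s, hs, t, hst, ht⟩ := hf
  have hx' : (x : K) ≠ 0 := fun h => hx (Subtype.ext h)
  have hts : t = y ^ (n + 1) * ι s := by
    refine Subtype.ext (mul_left_cancel₀ hx' ?_)
    rw [← hst]
    simp only [f, ι]
    push_cast
    exact mul_assoc _ _ _
  obtain ⟨c, hcs⟩ := hφ s
  have hc0 : c ≠ 0 := by
    rintro rfl
    exact hs (hφp s (by rw [hcs, map_zero]))
  rw [hts, map_mul, map_pow, hy, hcs, natDegree_mul_C hc0, natDegree_X_pow] at ht
  omega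

lemma ringKrullDim_adjoin_pair_le_and_exists_eval {x y : K} (hxy : AlgebraicIndependent k ![x, y])
    (T : Subalgebra k K) (hT : T = Algebra.adjoin k {x, y}) (hx : x ∈ T) (hy : y ∈ T) :
    ringKrullDim T ≤ 2 ∧ ∃ φ : T →ₐ[k] k[X], φ ⟨x, hx⟩ = 0 ∧ φ ⟨y, hy⟩ = X := by
  have hT' : T = Algebra.adjoin k (Set.range ![x, y]) := by
    rw [hT, Matrix.range_cons_cons_empty]
  subst hT'
  let e := hxy.aevalEquiv
  have he0 : e (MvPolynomial.X 0) = ⟨x, hx⟩ := Subtype.ext (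
    (hxy.algebraMap_aevalEquiv _).trans (by simp))
  have he1 : e (MvPolynomial.X 1) = ⟨y, hy⟩ := Subtype.ext (
    (hxy.algebraMap_aevalEquiv _).trans (by simp))
  constructor
  · rw [← ringKrullDim_eq_of_ringEquiv e.toRingEquiv,
      MvPolynomial.ringKrullDim_of_isNoetherianRing]
    simp
  · refine ⟨(MvPolynomial.aeval ![0, X]).comp (e.symm : _ →ₐ[k] _), ?_, ?_⟩
    · simp [← he0]
    · simp [← he1]

end Helpers

/-- With `T = k[x,y]` and `R = k + xT`: `T` is a saturated depiction of `R`, yet `R` is not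
noetherian in codimension 1, since `R_{xT ∩ R}` is not noetherian. -/
theorem plane_saturated_depiction_not_noeth_codim_one
    (k K : Type*) [Field k] [IsAlgClosed k] [Field K] [Algebra k K]
    (x y : K) (hxy : AlgebraicIndependent k ![x, y])
    (T : Subalgebra k K) (hTdef : T = Algebra.adjoin k {x, y}) (hxT : x ∈ T)
    (xT : Ideal T) (hxTdef : xT = Ideal.span ({⟨x, hxT⟩} : Set T))
    (R : Subalgebra k K) (hRdef : R = kPlus T xT)
    (hfrac : IsFractionRing ↑R K) (hRT : R ≤ T) :
    IsDepiction R T ∧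
      IsSaturated R T hRT ∧
      ¬ NoethCodimOne R ∧
      ∃ hq : (xT.comap (Subalgebra.inclusion hRT)).IsPrime,
        ¬ IsNoetherianRing (locAt R (xT.comap (Subalgebra.inclusion hRT)) hq) := by
  have hyT : y ∈ T := hTdef ▸ Algebra.subset_adjoin (by simp)
  obtain ⟨hdim, φ, hφx, hφy⟩ := ringKrullDim_adjoin_pair_le_and_exists_eval hxy T hTdef hxT hyT
  have hTfg : T.FG := hTdef ▸ Subalgebra.fg_def.mpr ⟨_, Set.toFinite _, rfl⟩
  have hTnoeth : IsNoetherianRing T := isNoetherianRing_of_fg hTfg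
  let ι := Subalgebra.inclusion hRT
  let xt : T := ⟨x, hxT⟩
  have hx0 : xt ≠ 0 := fun h => hxy.ne_zero 0 (congrArg Subtype.val h)
  have hc : ∀ t : T, (xt * t : K) ∈ R := fun t => by
    rw [hRdef]
    refine ⟨0, xt * t, ?_, by simp⟩
    rw [hxTdef]
    exact Ideal.mul_mem_right _ _ (Ideal.mem_span_singleton_self _)
  have hrep : ∀ r : R, ∃ (c : k) (t : T), ι r = algebraMap k T c + xt * t := fun r => by
    obtain ⟨c, f, hf, hr⟩ : (r : K) ∈ kPlus T xT := hRdef ▸ r.2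
    rw [hxTdef, Ideal.mem_span_singleton'] at hf
    obtain ⟨t, rfl⟩ := hf
    exact ⟨c, t, Subtype.ext (by rw [mul_comm xt]; exact hr)⟩
  have hφR : ∀ r : R, ∃ c : k, φ (ι r) = Polynomial.C c := fun r => by
    obtain ⟨c, t, hr⟩ := hrep r
    exact ⟨c, by rw [hr, map_add, map_mul, hφx, zero_mul, add_zero, AlgHom.commutes]; rfl⟩
  have hmem : ∀ r : R, r ∈ xT.comap ι ↔ φ (ι r) = 0 := fun r => by
    rw [Ideal.mem_comap, hxTdef, Ideal.mem_span_singleton]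
    constructor
    · rintro ⟨t, ht⟩
      rw [ht, map_mul, hφx, zero_mul]
    · intro h
      obtain ⟨c, t, hr⟩ := hrep r
      rw [hr, map_add, map_mul, hφx, zero_mul, add_zero, AlgHom.commutes] at h
      have hc0 : c = 0 := Polynomial.C_eq_zero.mp h
      exact ⟨t, by rw [hr, hc0, map_zero, zero_add]⟩
  have hm : (xT.comap ι).IsPrime := by
    have : xT.comap ι = RingHom.ker (φ.comp ι) := Ideal.ext fun r => by
      rw [hmem, RingHom.mem_ker]; rfl
    rw [this]
    exact RingHom.ker_isPrime _
  have hmn : ¬ IsNoetherianRing (locAt R (xT.comap ι) hm) :=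
    not_isNoetherianRing_locAt hRT hx0 hc φ hφy hφR _ hm fun r h => (hmem r).mpr h
  have hxR : x ∈ R := by simpa [xt] using hc 1
  have hfact : ∀ r ∈ xT.comap ι, ∃ t : T, r = ⟨_, hc t⟩ := fun r hr => by
    rw [Ideal.mem_comap, hxTdef, Ideal.mem_span_singleton] at hr
    obtain ⟨t, ht⟩ := hr
    exact ⟨t, Subtype.ext (congrArg (fun z : T => (z : K)) ht)⟩
  have hxm : ∀ t : T, (⟨_, hc t⟩ : R) ∈ xT.comap ι := fun t => by
    rw [Ideal.mem_comap, hxTdef, Ideal.mem_span_singleton]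
    exact ⟨t, rfl⟩
  have huniq : ∀ p : Ideal R, p.IsPrime → (⟨x, hxR⟩ : R) ∈ p → p = xT.comap ι := by
    intro p hp hxp
    have hle : xT.comap ι ≤ p := fun r hr => by
      obtain ⟨t, rfl⟩ := hfact r hr
      refine hp.mem_of_pow_mem 2 ?_
      have : (⟨_, hc t⟩ : R) ^ 2 = ⟨x, hxR⟩ * ⟨_, hc (t ^ 2)⟩ :=
        Subtype.ext (by simp [xt]; ring)
      rw [this]
      exact p.mul_mem_right _ hxp
    refine le_antisymm (fun r hr => ?_) hle
    obtain ⟨c, t, hrt⟩ := hrep r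
    have hr' : r = algebraMap k R c + ⟨_, hc t⟩ :=
      Subtype.ext (congrArg (fun z : T => (z : K)) hrt)
    have hcp : algebraMap k R c ∈ p := by
      rw [hr'] at hr
      exact (p.add_mem_iff_left (hle (hxm t))).mp hr
    have hc0 : c = 0 := by
      by_contra h
      exact hp.ne_top (Ideal.eq_top_of_isUnit_mem _ hcp ((IsUnit.mk0 c h).map _))
    rw [hr', hc0, map_zero, zero_add]
    exact hxm t
  have hU : ∀ n : Ideal T, n.IsMaximal → xt ∉ n → memU R T hRT n := fun n hn hxn =>
    ⟨hn, locAt_comap_eq hRT hc n hn.isPrime hxn⟩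
  have hdep : IsDepiction R T :=
    { le := hRT
      fg := hTfg
      specSurj := fun p hp => by
        by_cases h : xT.comap ι ≤ p
        · have hpm := huniq p hp (h (by simpa [xt] using hxm 1))
          have hne : Ideal.span {xt} ≠ ⊤ := fun htop => hm.ne_top (by
            rw [hxTdef, show Ideal.span {(⟨x, hxT⟩ : T)} = ⊤ from htop, Ideal.comap_top])
          obtain ⟨n, hn, hxn⟩ := Ideal.exists_le_maximal _ hne
          refine ⟨n, hn.isPrime, (huniq _ (hn.isPrime.comap _) ?_).trans hpm.symm⟩
          exact hxn (Ideal.mem_span_singleton_self _)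
        · obtain ⟨r, hr, hrp⟩ := SetLike.not_le_iff_exists.mp h
          obtain ⟨t, rfl⟩ := hfact r hr
          exact exists_isPrime_comap_eq hRT hc p hp hrp
      memU_iff := fun n hn => by
        constructor
        · rintro ⟨_, h⟩
          rw [h]
          exact isNoetherianRing_locAt T n hn.isPrime
        · intro h
          refine hU n hn fun hxn => hmn ?_
          rwa [← locAt_congr (huniq _ (hn.isPrime.comap ι) hxn)]
      nonempty := by
        by_contra! hall
        have : Algebra.FiniteType k T := (Subalgebra.fg_iff_finiteType T).mp hTfg
        have : IsJacobsonRing T := isJacobsonRing_of_finiteType (A := k)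
        have hbot : (⊥ : Ideal T).jacobson = ⊥ :=
          IsJacobsonRing.out inferInstance Ideal.isPrime_bot.isRadical
        refine hx0 ((Ideal.mem_bot (R := T)).mp (hbot ▸ Ideal.mem_sInf.mpr ?_))
        rintro n ⟨-, hn⟩
        exact by_contra fun h => hall n (hU n hn h) }
  refine ⟨hdep, fun q hq => ?_, ?_, hm, hmn⟩
  · have hqp : q.IsPrime := hq.1.1
    refine le_antisymm (sInf_le ⟨T, hdep, q, hqp, rfl, rfl⟩) (le_sInf ?_)
    rintro _ ⟨S, hd, q', hq', hcomap, rfl⟩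
    have key : q ≠ ⊥ → q' ≠ ⊥ := by
      rintro hq0 rfl
      refine hq0 (eq_bot_iff.mpr fun t ht => ?_)
      have h1 : (⟨_, hc t⟩ : R) ∈ q.comap ι := q.mul_mem_left xt ht
      rw [← hcomap, Ideal.mem_comap, Ideal.mem_bot] at h1
      have h2 : xt * t = 0 := Subtype.ext (congrArg (fun z : S => (z : K)) h1)
      exact (mul_eq_zero.mp h2).resolve_left hx0
    by_cases hq0 : q = ⊥
    · subst hq0
      rw [htOf_eq_height, htOf_eq_height, Ideal.height_bot]
      exact_mod_cast (zero_le : 0 ≤ q'.height)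
    have hone : 1 ≤ htOf q' := one_le_htOf q' (key hq0)
    by_cases hxq : xt ∈ q
    · refine (htOf_le_one_of_mem_minimalPrimes (a := xt) ?_).trans hone
      have hqm := huniq _ (hqp.comap ι) hxq
      have hmap : Ideal.map ι (q.comap ι) = Ideal.span {xt} := by
        rw [hqm]
        refine le_antisymm (Ideal.map_comap_le.trans_eq hxTdef) ?_
        rw [Ideal.span_singleton_le_iff_mem]
        have := Ideal.mem_map_of_mem ι (hxm 1)
        convert this using 1
        exact Subtype.ext (by simp [ι])
      rwa [← hmap]
    by_cases hmax : q.IsMaximal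
    · exact (htOf_eq_of_comap_eq_isMaximal hd hdep (hU q hmax hxq) q' hq' hcomap).ge
    · exact (htOf_le_one_of_not_isMaximal hdim q hmax).trans hone
  · rintro ⟨S, hd, hw⟩
    have : IsNoetherianRing S := isNoetherianRing_of_fg hd.fg
    let xs : S := Subalgebra.inclusion hd.le ⟨x, hxR⟩
    obtain ⟨q, hq, hqm⟩ := hd.specSurj _ hm
    have hxq : xs ∈ q := by
      have h1 : (⟨_, hc 1⟩ : R) ∈ q.comap (Subalgebra.inclusion hd.le) := hqm ▸ hxm 1
      simpa [xs, xt] using h1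
    obtain ⟨p, hp, -⟩ := Ideal.exists_minimalPrimes_le
      ((Ideal.span_singleton_le_iff_mem q).mpr hxq)
    have hpp : p.IsPrime := hp.1.1
    have hxp : xs ∈ p := hp.1.2 (Ideal.mem_span_singleton_self _)
    have hxs0 : xs ≠ 0 := fun h => hxy.ne_zero 0 (congrArg Subtype.val h)
    have hht : htOf p = 1 := (htOf_le_one_of_mem_minimalPrimes hp).antisymm
      (one_le_htOf p fun h => hxs0 (by simpa [h] using hxp))
    obtain ⟨-, n, hn, hpn⟩ := hw p hpp hht
    have hnm := hn.1
    have hnoeth := (hd.memU_iff n hnm).mp hn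
    refine hmn ?_
    rwa [← locAt_congr (huniq _ (hnm.isPrime.comap (Subalgebra.inclusion hd.le)) (hpn hxp))]
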